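/- Let 1 ≤ p ≤ ∞, let L_p = L_p(μ) be a Lebesgue space over a measure space, let s > |1/2 − 1/p|, and let K be a nonempty compact subset of L_p such that d_n(K)_{L_p} ≤ C0·max(1,n)^{-s} for all n ≥ 0, where C0 > 0. Then for every greedy sequence for K and every n ≥ 2, σ_n(K)_{L_p} ≤ C0·16^{s}·2^{|1/2−1/p|}·√(log₂(2n))·n^{-s+|1/2−1/p|}, where log₂ denotes the binary logarithm. -/

import Mathlib

open scoped BigOperators NNReal ENNReal

noncomputable section

/-- The span of the first `n` elements of the sequence `f`. -/
def greedySpan {X : Type*} [NormedAddCommGroup X] [NormedSpace ℝ X]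
    (f : ℕ → X) (n : ℕ) : Submodule ℝ X :=
  Submodule.span ℝ (f '' Set.Iio n)

/-- The `n`-th greedy error `σ_n = dist(f_n, V_n)`. For `n = 0` this is `‖f 0‖`. -/
def greedyErr {X : Type*} [NormedAddCommGroup X] [NormedSpace ℝ X]
    (f : ℕ → X) (n : ℕ) : ℝ :=
  Metric.infDist (f n) (greedySpan f n : Set X)

/-- `f` is a greedy sequence for `K`: each `f n` lies in `K` and maximizes the distance to
`V_n = span{f_0,…,f_{n-1}}` among elements of `K` (for `n = 0`, `‖f 0‖ = max_{g∈K} ‖g‖`). -/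
def IsGreedySeq {X : Type*} [NormedAddCommGroup X] [NormedSpace ℝ X]
    (K : Set X) (f : ℕ → X) : Prop :=
  ∀ n : ℕ, f n ∈ K ∧ ∀ g ∈ K, Metric.infDist g (greedySpan f n : Set X) ≤ greedyErr f n

/-- Kolmogorov `n`-width of a set `K ⊆ X`. -/
def kolWidth {X : Type*} [NormedAddCommGroup X] [NormedSpace ℝ X]
    (K : Set X) : ℕ → ℝ
  | 0 => ⨆ g ∈ K, ‖g‖
  | (n+1) => ⨅ L : {L : Submodule ℝ X // Module.finrank ℝ L = n + 1},
      ⨆ g ∈ K, Metric.infDist g (L.1 : Set X)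

/-- Kolmogorov `n`-width of a bounded linear operator `T : E → X`. -/
def kolWidthOp {E X : Type*} [NormedAddCommGroup E] [NormedSpace ℝ E]
    [NormedAddCommGroup X] [NormedSpace ℝ X] (T : E →L[ℝ] X) : ℕ → ℝ
  | 0 => ‖T‖
  | (n+1) => ⨅ L : {L : Submodule ℝ X // Module.finrank ℝ L = n + 1},
      ⨆ x : {x : E // ‖x‖ ≤ 1}, Metric.infDist (T x.1) (L.1 : Set X)

/-- Gelfand `n`-width of a bounded linear operator `T : E → X`. -/
def gelfandWidthOp {E X : Type*} [NormedAddCommGroup E] [NormedSpace ℝ E]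
    [NormedAddCommGroup X] [NormedSpace ℝ X] (T : E →L[ℝ] X) : ℕ → ℝ
  | 0 => ‖T‖
  | (n+1) => ⨅ L : {L : Submodule ℝ E // IsClosed (L : Set E) ∧
        FiniteDimensional ℝ (E ⧸ L) ∧ Module.finrank ℝ (E ⧸ L) ≤ n + 1},
      ⨆ x : {x : E // x ∈ L.1 ∧ ‖x‖ ≤ 1}, ‖T x.1‖

/-- The `n`-th Grothendieck number of a bounded linear operator `T : X → Y`. -/
def grothOp {X Y : Type*} [NormedAddCommGroup X] [NormedSpace ℝ X]
    [NormedAddCommGroup Y] [NormedSpace ℝ Y] (T : X →L[ℝ] Y) (n : ℕ) : ℝ :=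
  ⨆ p : (Fin n → {x : X // ‖x‖ ≤ 1}) × (Fin n → {b : Y →L[ℝ] ℝ // ‖b‖ ≤ 1}),
    |Matrix.det (Matrix.of fun i j => (p.2 j).1 (T (p.1 i).1))| ^ ((1 : ℝ) / n)

/-- The `n`-th Grothendieck number of the Banach space `X`. -/
def groth (X : Type*) [NormedAddCommGroup X] [NormedSpace ℝ X] (n : ℕ) : ℝ :=
  grothOp (ContinuousLinearMap.id ℝ X) n

/-- Banach–Mazur distance between two normed spaces. -/
def bmDist (X Y : Type*) [NormedAddCommGroup X] [NormedSpace ℝ X]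
    [NormedAddCommGroup Y] [NormedSpace ℝ Y] : ℝ :=
  ⨅ T : X ≃L[ℝ] Y, ‖(T : X →L[ℝ] Y)‖ * ‖(T.symm : Y →L[ℝ] X)‖

/-- `γ_n(X)`: supremum of Banach–Mazur distances of `n`-dimensional subspaces of `X`
to `n`-dimensional Euclidean space. -/
def gammaBM (X : Type*) [NormedAddCommGroup X] [NormedSpace ℝ X] (n : ℕ) : ℝ :=
  ⨆ V : {V : Submodule ℝ X // Module.finrank ℝ V = n},
    bmDist V.1 (EuclideanSpace ℝ (Fin n))

/-- `T` satisfies the absolutely 2-summing inequality with constant `C`. -/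
def Summing2Bound {X Y : Type*} [NormedAddCommGroup X] [NormedSpace ℝ X]
    [NormedAddCommGroup Y] [NormedSpace ℝ Y] (T : X →L[ℝ] Y) (C : ℝ) : Prop :=
  ∀ (N : ℕ) (x : Fin N → X),
    (∑ i, ‖T (x i)‖ ^ 2) ^ ((1 : ℝ) / 2) ≤
      C * ⨆ b : {b : X →L[ℝ] ℝ // ‖b‖ ≤ 1}, (∑ i, (b.1 (x i)) ^ 2) ^ ((1 : ℝ) / 2)

/-- `T` is absolutely 2-summing. -/
def IsSumming2 {X Y : Type*} [NormedAddCommGroup X] [NormedSpace ℝ X]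
    [NormedAddCommGroup Y] [NormedSpace ℝ Y] (T : X →L[ℝ] Y) : Prop :=
  ∃ C : ℝ, 0 ≤ C ∧ Summing2Bound T C

/-- The 2-summing norm `‖T | B₂‖`. -/
def summing2Norm {X Y : Type*} [NormedAddCommGroup X] [NormedSpace ℝ X]
    [NormedAddCommGroup Y] [NormedSpace ℝ Y] (T : X →L[ℝ] Y) : ℝ :=
  sInf {C : ℝ | 0 ≤ C ∧ Summing2Bound T C}

end


/-- The alternating form `x ↦ det (g j (x i))`. -/
noncomputable def detForm {X : Type*} [NormedAddCommGroup X] [NormedSpace ℝ X] {n : ℕ}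
    (g : Fin n → (X →L[ℝ] ℝ)) : X [⋀^Fin n]→ₗ[ℝ] ℝ :=
  Matrix.detRowAlternating.compLinearMap (LinearMap.pi fun j => (g j : X →ₗ[ℝ] ℝ))

theorem detForm_apply {X : Type*} [NormedAddCommGroup X] [NormedSpace ℝ X] {n : ℕ}
    (g : Fin n → (X →L[ℝ] ℝ)) (x : Fin n → X) :
    detForm g x = (Matrix.of fun i j => g j (x i)).det := rfl

/-- Hadamard's inequality in an orthonormal basis. -/
theorem OrthonormalBasis.abs_det_le {E : Type*} [NormedAddCommGroup E] [InnerProductSpace ℝ E]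
    {n : ℕ} (b : OrthonormalBasis (Fin n) ℝ E) (x : Fin n → E) :
    |b.toBasis.det x| ≤ ∏ i, ‖x i‖ := by
  have : FiniteDimensional ℝ E := b.toBasis.finiteDimensional_of_finite
  have : Fact (Module.finrank ℝ E = n) := ⟨by simpa using Module.finrank_eq_card_basis b.toBasis⟩
  rw [← b.toBasis.orientation.volumeForm_robust b rfl]
  exact Orientation.abs_volumeForm_apply_le _ x

/-- Hadamard's inequality for mixed Gram determinants. -/
theorem abs_det_inner_le {H : Type*} [NormedAddCommGroup H] [InnerProductSpace ℝ H] {n : ℕ}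
    (g h : Fin n → H) :
    |(Matrix.of fun i j => inner ℝ (g j) (h i)).det| ≤ (∏ j, ‖g j‖) * ∏ i, ‖h i‖ := by
  have hform : ∀ x : Fin n → H, (Matrix.of fun i j => inner ℝ (g j) (x i)).det
      = detForm (fun j => innerSL ℝ (g j)) x := fun x => rfl
  by_cases hli : LinearIndependent ℝ h
  · set W := Submodule.span ℝ (Set.range h)
    have hfin : Module.finrank ℝ W = n := by
      simpa using finrank_span_eq_card hli
    have : FiniteDimensional ℝ W := FiniteDimensional.span_of_finite ℝ (Set.finite_range h)
    let b : OrthonormalBasis (Fin n) ℝ W :=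
      (stdOrthonormalBasis ℝ W).reindex (finCongr hfin)
    let h' : Fin n → W := fun i => ⟨h i, Submodule.subset_span ⟨i, rfl⟩⟩
    let g' : Fin n → W := fun i => W.orthogonalProjectionOnto (g i)
    have key := AlternatingMap.eq_smul_basis_det b.toBasis
      ((detForm (fun j => innerSL ℝ (g j))).compLinearMap W.subtype)
    have h1 := congrArg (fun F => F h') key
    have h2 : ((detForm (fun j => innerSL ℝ (g j))).compLinearMap W.subtype) b.toBasis
        = b.toBasis.det g' := by
      rw [Module.Basis.det_apply]
      change (Matrix.of fun i j => inner ℝ (g j) ((b.toBasis i : W) : H)).det = _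
      congr 1
      ext i j
      rw [Module.Basis.toMatrix_apply]
      simp only [Matrix.of_apply, OrthonormalBasis.coe_toBasis,
        OrthonormalBasis.coe_toBasis_repr_apply, OrthonormalBasis.repr_apply_apply, g']
      rw [Submodule.inner_orthogonalProjectionOnto_eq_of_mem_left, real_inner_comm]
    rw [hform]
    have h3 : detForm (fun j => innerSL ℝ (g j)) h = b.toBasis.det g' * b.toBasis.det h' := by
      rw [← h2]; exact h1
    rw [h3, abs_mul]
    refine mul_le_mul ((b.abs_det_le g').trans ?_) (b.abs_det_le h') (abs_nonneg _)
      (Finset.prod_nonneg fun _ _ => norm_nonneg _)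
    exact Finset.prod_le_prod (fun _ _ => norm_nonneg _)
      fun i _ => W.norm_orthogonalProjectionOnto_apply_le _
  · rw [hform, AlternatingMap.map_linearDependent _ _ hli, abs_zero]
    positivity

/-- Determinants of vectors that factor through a Hilbert space. -/
theorem abs_detForm_comp_le {X H : Type*} [NormedAddCommGroup X] [NormedSpace ℝ X]
    [NormedAddCommGroup H] [InnerProductSpace ℝ H] [CompleteSpace H] {n : ℕ}
    (T : H →L[ℝ] X) {B : ℝ} (hT : ‖T‖ ≤ B) (g : Fin n → (X →L[ℝ] ℝ)) (h : Fin n → H) :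
    |detForm g (fun i => T (h i))| ≤ B ^ n * (∏ j, ‖g j‖) * ∏ i, ‖h i‖ := by
  let G : Fin n → H := fun j => (InnerProductSpace.toDual ℝ H).symm ((g j).comp T)
  have hG : ∀ j, ‖G j‖ ≤ B * ‖g j‖ := fun j => by
    simp only [G, LinearIsometryEquiv.norm_map]
    refine ((g j).opNorm_comp_le T).trans ?_
    rw [mul_comm]
    gcongr
  have h1 : detForm g (fun i => T (h i)) = (Matrix.of fun i j => inner ℝ (G j) (h i)).det := by
    rw [detForm_apply]
    congr 1
    ext i j
    simp [G]
  rw [h1]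
  refine (abs_det_inner_le G h).trans ?_
  refine mul_le_mul_of_nonneg_right ?_ (Finset.prod_nonneg fun _ _ => norm_nonneg _)
  calc ∏ j, ‖G j‖ ≤ ∏ j, (B * ‖g j‖) :=
        Finset.prod_le_prod (fun _ _ => norm_nonneg _) fun j _ => hG j
    _ = B ^ n * ∏ j, ‖g j‖ := by simp [Finset.prod_mul_distrib]

/-- The pointwise change of density behind `exists_factor_through_L2`. -/
theorem sq_div_le_and_mul_div_eq_of_sum_rpow {n : ℕ} {q : ℝ} (hq1 : 1 ≤ q) (hq2 : q ≤ 2) (a : Fin n → ℝ)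
    (i : Fin n) :
    (a i / (∑ j, |a j| ^ q) ^ (1 / q - 1 / 2)) ^ 2 ≤ |a i| ^ q ∧
      (∑ j, |a j| ^ q) ^ (1 / q - 1 / 2) * (a i / (∑ j, |a j| ^ q) ^ (1 / q - 1 / 2)) = a i := by
  have hq : 0 < q := by linarith
  rcases eq_or_ne (a i) 0 with h0 | h0
  · simp [h0, hq.ne']
  have hpos : 0 < |a i| := abs_pos.mpr h0
  have hα : 0 ≤ 1 / q - 1 / 2 := by
    have := one_div_le_one_div_of_le hq hq2
    linarith
  have hle : |a i| ^ q ≤ ∑ j, |a j| ^ q :=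
    Finset.single_le_sum (f := fun j => |a j| ^ q)
      (fun j _ => Real.rpow_nonneg (abs_nonneg _) _) (Finset.mem_univ i)
  have hu : |a i| ^ (1 - q / 2) ≤ (∑ j, |a j| ^ q) ^ (1 / q - 1 / 2) := by
    have h := Real.rpow_le_rpow (Real.rpow_nonneg (abs_nonneg (a i)) q) hle hα
    rw [← Real.rpow_mul (abs_nonneg _)] at h
    convert h using 2
    field_simp
  have hupos : 0 < (∑ j, |a j| ^ q) ^ (1 / q - 1 / 2) :=
    (Real.rpow_pos_of_pos hpos _).trans_le hu
  refine ⟨?_, mul_div_cancel₀ _ hupos.ne'⟩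
  rw [div_pow, div_le_iff₀ (by positivity), ← sq_abs]
  calc |a i| ^ 2 = |a i| ^ q * (|a i| ^ (1 - q / 2)) ^ 2 := by
        rw [← Real.rpow_natCast, ← Real.rpow_natCast, ← Real.rpow_mul hpos.le,
          ← Real.rpow_add hpos]
        congr 1
        push_cast
        ring
    _ ≤ _ := by gcongr

open MeasureTheory in
theorem lintegral_enorm_rpow_le_one {Ω : Type*} [MeasurableSpace Ω] {ν : Measure Ω} {q : ℝ≥0∞}
    (hq0 : q ≠ 0) (hqt : q ≠ ∞) (f : Lp ℝ q ν) (hf : ‖f‖ ≤ 1) :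
    ∫⁻ ω, ENNReal.ofReal (|f ω| ^ q.toReal) ∂ν ≤ 1 := by
  have h1 : eLpNorm f q ν ≤ 1 := by
    rw [Lp.norm_def] at hf
    rw [← ENNReal.toReal_one] at hf
    exact (ENNReal.toReal_le_toReal (Lp.eLpNorm_ne_top f) ENNReal.one_ne_top).mp hf
  have h2 : ∀ ω, ENNReal.ofReal (|f ω| ^ q.toReal) = ‖f ω‖ₑ ^ q.toReal := fun ω => by
    rw [← ENNReal.ofReal_rpow_of_nonneg (abs_nonneg _) ENNReal.toReal_nonneg,
      Real.enorm_eq_ofReal_abs]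
  simp_rw [h2]
  rw [eLpNorm_eq_lintegral_rpow_enorm_toReal hq0 hqt] at h1
  have hpos : 0 < q.toReal := ENNReal.toReal_pos hq0 hqt
  by_contra hcon
  push Not at hcon
  exact absurd h1 (not_le.mpr (ENNReal.one_lt_rpow hcon (by positivity)))

open MeasureTheory in
/-- Any `n` elements of the unit ball of `L_q`, `1 ≤ q ≤ 2`, are images of elements of the unit
ball of `L_2` under a multiplication operator of norm at most `n ^ (1/q - 1/2)`. -/
theorem exists_factor_through_L2 {Ω : Type*} [MeasurableSpace Ω] {ν : Measure Ω} {q : ℝ≥0∞}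
    [hq : Fact (1 ≤ q)] (hq2 : q ≤ 2) {n : ℕ} (y : Fin n → Lp ℝ q ν) (hy : ∀ i, ‖y i‖ ≤ 1) :
    ∃ T : Lp ℝ 2 ν →L[ℝ] Lp ℝ q ν, ‖T‖ ≤ (n : ℝ) ^ (1 / q.toReal - 1 / 2) ∧
      ∃ h : Fin n → Lp ℝ 2 ν, (∀ i, ‖h i‖ ≤ 1) ∧ ∀ i, T (h i) = y i := by
  have hqt : q ≠ ∞ := ne_top_of_le_ne_top (by simp) hq2
  have hq0 : q ≠ 0 := (zero_lt_one.trans_le hq.out).ne'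
  have hQ1 : 1 ≤ q.toReal := by
    simpa using ENNReal.toReal_mono hqt hq.out
  have hQ2 : q.toReal ≤ 2 := by
    simpa using ENNReal.toReal_mono (by simp) hq2
  set Q := q.toReal with hQ
  set α := 1 / Q - 1 / 2 with hα
  have hQpos : 0 < Q := by linarith
  have hα0 : 0 ≤ α := by
    have := one_div_le_one_div_of_le hQpos hQ2
    linarith
  set r : ℝ≥0∞ := (ENNReal.ofReal α)⁻¹ with hr
  have htriple : ENNReal.HolderTriple r 2 q := ⟨by
    rw [hr, inv_inv]
    have e1 : q⁻¹ = ENNReal.ofReal (1 / Q) := by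
      rw [one_div, ENNReal.ofReal_inv_of_pos hQpos, hQ, ENNReal.ofReal_toReal hqt]
    have e2 : (2 : ℝ≥0∞)⁻¹ = ENNReal.ofReal (1 / 2) := by
      rw [one_div, ENNReal.ofReal_inv_of_pos two_pos]
      simp
    rw [e1, e2, ← ENNReal.ofReal_add hα0 (by norm_num)]
    congr 1
    ring⟩
  have hr1 : Fact (1 ≤ r) := ⟨by
    rw [hr, ENNReal.one_le_inv, ENNReal.ofReal_le_one]
    have := one_div_le_one_div_of_le one_pos hQ1
    linarith⟩
  let S : Ω → ℝ := fun ω => ∑ j, |y j ω| ^ Q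
  have hS0 : ∀ ω, 0 ≤ S ω := fun ω =>
    Finset.sum_nonneg fun j _ => Real.rpow_nonneg (abs_nonneg _) _
  have hmeasY : ∀ j, StronglyMeasurable (y j) := fun j => Lp.stronglyMeasurable _
  have hmeasS : Measurable S := by
    refine Finset.measurable_fun_sum _ fun j _ => ?_
    exact ((hmeasY j).measurable.abs).pow_const _
  let u : Ω → ℝ := fun ω => S ω ^ α
  have hmeasU : Measurable u := hmeasS.pow_const _
  have hSint : ∫⁻ ω, ENNReal.ofReal (S ω) ∂ν ≤ n := by
    have : ∀ ω, ENNReal.ofReal (S ω) = ∑ j, ENNReal.ofReal (|y j ω| ^ Q) := fun ω =>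
      ENNReal.ofReal_sum_of_nonneg fun j _ => Real.rpow_nonneg (abs_nonneg _) _
    simp_rw [this]
    rw [lintegral_finsetSum _ fun j _ =>
      (((hmeasY j).measurable.abs).pow_const _).ennreal_ofReal]
    calc _ ≤ ∑ j : Fin n, (1 : ℝ≥0∞) :=
          Finset.sum_le_sum fun j _ => lintegral_enorm_rpow_le_one hq0 hqt (y j) (hy j)
      _ = n := by simp
  have hu : eLpNorm u r ν ≤ ENNReal.ofReal ((n : ℝ) ^ α) := by
    rcases hα0.eq_or_lt with h0 | hpos
    · have hrt : r = ∞ := by simp [hr, ← h0]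
      rw [hrt, eLpNorm_exponent_top]
      refine eLpNormEssSup_le_of_ae_bound (.of_forall fun ω => ?_)
      simp [u, ← h0]
    · have hrt : r ≠ ∞ := by simp [hr, hpos]
      have hr0 : r ≠ 0 := (zero_lt_one.trans_le hr1.out).ne'
      have hrr : r.toReal = 1 / α := by
        simp [hr, ENNReal.toReal_inv, ENNReal.toReal_ofReal hα0]
      rw [eLpNorm_eq_lintegral_rpow_enorm_toReal hr0 hrt, hrr, one_div_one_div]
      have : ∀ ω, ‖u ω‖ₑ ^ (1 / α) = ENNReal.ofReal (S ω) := fun ω => by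
        rw [Real.enorm_eq_ofReal_abs, abs_of_nonneg (Real.rpow_nonneg (hS0 ω) _),
          ENNReal.ofReal_rpow_of_nonneg (Real.rpow_nonneg (hS0 ω) _) (by positivity),
          ← Real.rpow_mul (hS0 ω), mul_one_div_cancel hpos.ne', Real.rpow_one]
      simp_rw [this]
      rw [← ENNReal.ofReal_rpow_of_nonneg (by positivity) hα0, ENNReal.ofReal_natCast]
      exact ENNReal.rpow_le_rpow hSint hα0
  have huL : MemLp u r ν :=
    ⟨hmeasU.aestronglyMeasurable, hu.trans_lt ENNReal.ofReal_lt_top⟩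
  let U : Lp ℝ r ν := huL.toLp u
  have hU : ‖U‖ ≤ (n : ℝ) ^ α := by
    rw [Lp.norm_toLp]
    exact ENNReal.toReal_le_of_le_ofReal (by positivity) hu
  let h : Fin n → Ω → ℝ := fun i ω => y i ω / u ω
  have hh : ∀ i, eLpNorm (h i) 2 ν ≤ 1 := fun i => by
    rw [eLpNorm_eq_lintegral_rpow_enorm_toReal two_ne_zero (by simp)]
    refine ENNReal.rpow_le_one ?_ (by positivity)
    refine le_trans (lintegral_mono fun ω => ?_)
      (lintegral_enorm_rpow_le_one hq0 hqt (y i) (hy i))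
    rw [Real.enorm_eq_ofReal_abs, ENNReal.ofReal_rpow_of_nonneg (abs_nonneg _) (by positivity)]
    refine ENNReal.ofReal_le_ofReal ?_
    have := (sq_div_le_and_mul_div_eq_of_sum_rpow hQ1 hQ2 (fun j => y j ω) i).1
    rw [show (2 : ℝ≥0∞).toReal = 2 by simp, Real.rpow_two, sq_abs]
    exact this
  have hhL : ∀ i, MemLp (h i) 2 ν := fun i =>
    ⟨((hmeasY i).measurable.div hmeasU).aestronglyMeasurable, (hh i).trans_lt ENNReal.one_lt_top⟩
  refine ⟨(ContinuousLinearMap.mul ℝ ℝ).holderL ν r 2 q U, ?_, fun i => (hhL i).toLp (h i),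
    fun i => ?_, fun i => ?_⟩
  · refine (ContinuousLinearMap.le_opNorm _ _).trans (le_trans ?_ hU)
    refine mul_le_of_le_one_left (norm_nonneg _) ?_
    exact (ContinuousLinearMap.norm_holderL_le _).trans
      (ContinuousLinearMap.opNorm_mul_le ℝ ℝ)
  · rw [Lp.norm_toLp]
    exact ENNReal.toReal_le_of_le_ofReal zero_le_one (by simpa using hh i)
  · rw [ContinuousLinearMap.holderL_apply_apply]
    refine Lp.ext ?_
    filter_upwards [(ContinuousLinearMap.mul ℝ ℝ).coeFn_holder (r := q) U ((hhL i).toLp (h i)),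
      huL.coeFn_toLp, (hhL i).coeFn_toLp] with ω h1 h2 h3
    rw [h1, h2, h3]
    exact (sq_div_le_and_mul_div_eq_of_sum_rpow hQ1 hQ2 (fun j => y j ω) i).2

/-- A bound for unit vectors extends to all vectors by homogeneity. -/
theorem abs_detForm_le_of_unit {X : Type*} [NormedAddCommGroup X] [NormedSpace ℝ X] {n : ℕ}
    {B : ℝ} (hB : ∀ (g : Fin n → (X →L[ℝ] ℝ)) (x : Fin n → X), (∀ j, ‖g j‖ ≤ 1) →
      (∀ i, ‖x i‖ ≤ 1) → |detForm g x| ≤ B)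
    (g : Fin n → (X →L[ℝ] ℝ)) (hg : ∀ j, ‖g j‖ ≤ 1) (x : Fin n → X) :
    |detForm g x| ≤ B * ∏ i, ‖x i‖ := by
  have h1 := hB g (fun i => ‖x i‖⁻¹ • x i) hg fun i => by
    rw [norm_smul, norm_inv, norm_norm]
    exact inv_mul_le_one
  have h2 : detForm g x = (∏ i, ‖x i‖) * detForm g (fun i => ‖x i‖⁻¹ • x i) := by
    rw [← smul_eq_mul, ← AlternatingMap.coe_multilinearMap, ← MultilinearMap.map_smul_univ]
    congr 1
    funext i
    by_cases hx : x i = 0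
    · simp [hx]
    · rw [smul_smul, mul_inv_cancel₀ (norm_ne_zero_iff.mpr hx), one_smul]
  rw [h2, abs_mul, abs_of_nonneg (Finset.prod_nonneg fun _ _ => norm_nonneg _), mul_comm]
  gcongr

open MeasureTheory in
/-- The determinant bound in `L_q`, `1 ≤ q ≤ 2`. -/
theorem abs_detForm_le_of_le_two {Ω : Type*} [MeasurableSpace Ω] {ν : Measure Ω} {q : ℝ≥0∞}
    [Fact (1 ≤ q)] (hq2 : q ≤ 2) {n : ℕ} (g : Fin n → (Lp ℝ q ν →L[ℝ] ℝ))
    (y : Fin n → Lp ℝ q ν) (hg : ∀ j, ‖g j‖ ≤ 1) (hy : ∀ i, ‖y i‖ ≤ 1) :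
    |detForm g y| ≤ ((n : ℝ) ^ (1 / q.toReal - 1 / 2)) ^ n := by
  obtain ⟨T, hT, h, hh, hTh⟩ := exists_factor_through_L2 hq2 y hy
  have h1 := abs_detForm_comp_le T hT g h
  simp_rw [hTh] at h1
  refine h1.trans ?_
  have hp1 : ∏ j, ‖g j‖ ≤ 1 := Finset.prod_le_one (fun _ _ => norm_nonneg _) fun j _ => hg j
  have hp2 : ∏ j, ‖h j‖ ≤ 1 := Finset.prod_le_one (fun _ _ => norm_nonneg _) fun j _ => hh j
  rw [mul_assoc]
  refine mul_le_of_le_one_right (by positivity) ?_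
  exact mul_le_one₀ hp1 (Finset.prod_nonneg fun _ _ => norm_nonneg _) hp2

/-- The determinant bound valid in every normed space. -/
theorem abs_detForm_le_sqrt {X : Type*} [NormedAddCommGroup X] [NormedSpace ℝ X] {n : ℕ}
    (g : Fin n → (X →L[ℝ] ℝ)) (x : Fin n → X) (hg : ∀ j, ‖g j‖ ≤ 1) (hx : ∀ i, ‖x i‖ ≤ 1) :
    |detForm g x| ≤ ((n : ℝ) ^ ((1 : ℝ) / 2)) ^ n := by
  let v : Fin n → EuclideanSpace ℝ (Fin n) := fun i => WithLp.toLp 2 fun j => g j (x i)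
  have h1 : detForm g x = (EuclideanSpace.basisFun (Fin n) ℝ).toBasis.det v := by
    rw [detForm_apply, Module.Basis.det_apply, ← Matrix.det_transpose]
    rfl
  rw [h1]
  refine (OrthonormalBasis.abs_det_le _ v).trans ?_
  calc ∏ i, ‖v i‖ ≤ ∏ i : Fin n, (n : ℝ) ^ ((1 : ℝ) / 2) := by
        refine Finset.prod_le_prod (fun _ _ => norm_nonneg _) fun i _ => ?_
        rw [EuclideanSpace.norm_eq, ← Real.sqrt_eq_rpow]
        refine Real.sqrt_le_sqrt ?_
        calc ∑ j, ‖v i j‖ ^ 2 ≤ ∑ j : Fin n, (1 : ℝ) := by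
              refine Finset.sum_le_sum fun j _ => ?_
              refine pow_le_one₀ (norm_nonneg _) ?_
              exact ((g j).le_opNorm (x i)).trans
                (mul_le_one₀ (hg j) (norm_nonneg _) (hx i))
          _ = n := by simp
    _ = _ := by simp

open MeasureTheory in
theorem norm_lpPairing_apply_le {Ω : Type*} [MeasurableSpace Ω] {ν : Measure Ω} {p q : ℝ≥0∞}
    [Fact (1 ≤ p)] [Fact (1 ≤ q)] [ENNReal.HolderConjugate p q] (y : Lp ℝ p ν) (x : Lp ℝ q ν) :
    ‖(ContinuousLinearMap.mul ℝ ℝ).lpPairing ν p q y x‖ ≤ ‖y‖ * ‖x‖ := by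
  have h1 : (ContinuousLinearMap.mul ℝ ℝ).lpPairing ν p q y x
      = L1.integral ((ContinuousLinearMap.mul ℝ ℝ).holder 1 y x) := by
    rw [ContinuousLinearMap.lpPairing_eq_integral, L1.integral_eq_integral]
    exact (integral_congr_ae ((ContinuousLinearMap.mul ℝ ℝ).coeFn_holder y x)).symm
  rw [h1]
  refine (L1.norm_integral_le _).trans ?_
  refine (ContinuousLinearMap.norm_holder_apply_apply_le _ y x).trans ?_
  rw [mul_assoc]
  exact mul_le_of_le_one_left (by positivity) (ContinuousLinearMap.opNorm_mul_le ℝ ℝ)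

open MeasureTheory in
/-- Norming elements of the dual exponent, for `2 ≤ p < ∞`. -/
theorem exists_lpPairing_eq_norm {Ω : Type*} [MeasurableSpace Ω] {ν : Measure Ω} {p q : ℝ≥0∞}
    [Fact (1 ≤ p)] [Fact (1 ≤ q)] [hpq : ENNReal.HolderConjugate q p] (hp2 : 2 ≤ p) (hpt : p ≠ ∞)
    (x : Lp ℝ p ν) :
    ∃ y : Lp ℝ q ν, ‖y‖ ≤ 1 ∧ (ContinuousLinearMap.mul ℝ ℝ).lpPairing ν q p y x = ‖x‖ := by
  rcases eq_or_ne x 0 with rfl | hx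
  · exact ⟨0, by simp⟩
  have hnx : 0 < ‖x‖ := norm_pos_iff.mpr hx
  set P := p.toReal with hP
  have hP2 : 2 ≤ P := by simpa using ENNReal.toReal_mono hpt hp2
  have hmul : q * ENNReal.ofReal (P - 1) = p := by
    have hqt : q ≠ ∞ := by
      rintro rfl
      have h1 := hpq.inv_add_inv_eq_inv
      simp only [ENNReal.inv_top, zero_add, inv_one] at h1
      rw [ENNReal.inv_eq_one] at h1
      rw [h1] at hp2
      norm_num at hp2
    have hq0 : q ≠ 0 := (zero_lt_one.trans_le (Fact.out : 1 ≤ q)).ne'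
    have hr : q.toReal⁻¹ + P⁻¹ = 1 := by
      have h1 := congrArg ENNReal.toReal hpq.inv_add_inv_eq_inv
      rwa [ENNReal.toReal_add (by simp [hq0]) (by
        rw [Ne, ENNReal.inv_eq_top]
        rintro rfl
        simp at hp2), ENNReal.toReal_inv, ENNReal.toReal_inv, inv_one, ENNReal.toReal_one] at h1
    have hQ : 0 < q.toReal := ENNReal.toReal_pos hq0 hqt
    have h2 : q.toReal * (P - 1) = P := by
      field_simp at hr
      linarith
    rw [← ENNReal.ofReal_toReal hqt, ← ENNReal.ofReal_mul hQ.le, h2, hP,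
      ENNReal.ofReal_toReal hpt]
  let Y : Ω → ℝ := fun ω => x ω * |x ω| ^ (P - 2)
  have hYn : ∀ ω, ‖Y ω‖ = ‖x ω‖ ^ (P - 1) := fun ω => by
    rcases eq_or_ne (x ω) 0 with h0 | h0
    · simp [Y, h0, Real.zero_rpow (show P - 1 ≠ 0 by linarith)]
    · have : 0 < |x ω| := abs_pos.mpr h0
      rw [Real.norm_eq_abs, Real.norm_eq_abs, abs_mul,
        abs_of_nonneg (Real.rpow_nonneg this.le _)]
      nth_rewrite 1 [← Real.rpow_one |x ω|]
      rw [← Real.rpow_add this]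
      congr 1
      ring
  have hYe : eLpNorm Y q ν = eLpNorm x p ν ^ (P - 1) := by
    rw [← eLpNorm_norm Y]
    simp_rw [hYn]
    rw [eLpNorm_norm_rpow _ (by linarith), hmul]
  have hmx : Measurable x := (Lp.stronglyMeasurable x).measurable
  have hYL : MemLp Y q ν := ⟨(hmx.mul (hmx.abs.pow_const _)).aestronglyMeasurable, by
    rw [hYe]
    exact ENNReal.rpow_lt_top_of_nonneg (by linarith) (Lp.eLpNorm_ne_top x)⟩
  have hYnorm : ‖hYL.toLp Y‖ = ‖x‖ ^ (P - 1) := by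
    rw [Lp.norm_toLp, hYe, Lp.norm_def, ENNReal.toReal_rpow]
  have hpair : (ContinuousLinearMap.mul ℝ ℝ).lpPairing ν q p (hYL.toLp Y) x = ‖x‖ ^ P := by
    rw [ContinuousLinearMap.lpPairing_eq_integral]
    have h1 : ∫ ω, ContinuousLinearMap.mul ℝ ℝ ((hYL.toLp Y) ω) (x ω) ∂ν
        = ∫ ω, ‖x ω‖ ^ P ∂ν := by
      refine integral_congr_ae ?_
      filter_upwards [hYL.coeFn_toLp] with ω h2
      rw [h2]
      rcases eq_or_ne (x ω) 0 with h0 | h0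
      · simp [h0, Real.zero_rpow (show P ≠ 0 by linarith)]
      · have : 0 < |x ω| := abs_pos.mpr h0
        simp only [ContinuousLinearMap.mul_apply', Y, Real.norm_eq_abs]
        rw [mul_right_comm, ← abs_mul_abs_self, ← sq, ← Real.rpow_two, ← Real.rpow_add this]
        congr 1
        ring
    rw [h1, Lp.norm_def, (Lp.memLp x).eLpNorm_eq_integral_rpow_norm (by
      rintro rfl
      simp at hp2) hpt]
    have h3 : 0 ≤ ∫ ω, ‖x ω‖ ^ P ∂ν := integral_nonneg fun ω => by positivity
    rw [ENNReal.toReal_ofReal (Real.rpow_nonneg h3 _), ← Real.rpow_mul h3,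
      inv_mul_cancel₀ (by linarith), Real.rpow_one]
  refine ⟨(‖x‖ ^ (P - 1))⁻¹ • hYL.toLp Y, ?_, ?_⟩
  · rw [norm_smul, hYnorm, norm_inv, Real.norm_of_nonneg (by positivity)]
    exact inv_mul_le_one
  · rw [map_smul, smul_apply, hpair, smul_eq_mul, Real.rpow_sub_one hnx.ne']
    have : ‖x‖ ^ P ≠ 0 := (Real.rpow_pos_of_pos hnx _).ne'
    field_simp

/-- Helly's lemma: if the unit ball of `Y` norms `X`, then functionals on `X` are approximated on
finitely many points by elements of that ball. -/
theorem mem_closure_image_of_norming {X Y : Type*} [NormedAddCommGroup X] [NormedSpace ℝ X]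
    [NormedAddCommGroup Y] [NormedSpace ℝ Y] (pr : Y →L[ℝ] X →L[ℝ] ℝ)
    (hpr : ∀ z : X, ∃ y : Y, ‖y‖ ≤ 1 ∧ pr y z = ‖z‖) {n : ℕ} (x : Fin n → X)
    (g : X →L[ℝ] ℝ) (hg : ‖g‖ ≤ 1) :
    (fun j => g (x j)) ∈ closure ((fun (y : Y) j => pr y (x j)) '' Metric.closedBall 0 1) := by
  have hconv : Convex ℝ ((fun (y : Y) j => pr y (x j)) '' Metric.closedBall 0 1) :=
    (convex_closedBall (0 : Y) 1).is_linear_image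
      ⟨fun a b => by ext; simp, fun c a => by ext; simp⟩
  by_contra hcon
  obtain ⟨f, s, hf1, hf2⟩ := geometric_hahn_banach_closed_point hconv.closure
    isClosed_closure hcon
  let z : X := ∑ j, f (Pi.single j 1) • x j
  have hfexp : ∀ c : Fin n → ℝ, f c = ∑ j, f (Pi.single j 1) * c j := fun c => by
    conv_lhs => rw [pi_eq_sum_univ' c]
    rw [map_sum]
    refine Finset.sum_congr rfl fun j _ => ?_
    rw [map_smul, smul_eq_mul, mul_comm]
  obtain ⟨y, hy1, hy2⟩ := hpr z
  have h1 : f (fun j => pr y (x j)) = ‖z‖ := by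
    rw [← hy2, hfexp]
    simp [z]
  have h2 : f (fun j => g (x j)) = g z := by
    rw [hfexp]
    simp [z]
  have h3 : g z ≤ ‖z‖ := (le_abs_self _).trans
    ((g.le_opNorm z).trans (mul_le_of_le_one_left (norm_nonneg _) hg))
  have h4 := hf1 (fun j => pr y (x j)) (subset_closure ⟨y, by simpa using hy1, rfl⟩)
  linarith

/-- Determinant bounds pass from a norming space to the space it norms. -/
theorem abs_detForm_le_of_norming {X Y : Type*} [NormedAddCommGroup X] [NormedSpace ℝ X]
    [NormedAddCommGroup Y] [NormedSpace ℝ Y] (pr : Y →L[ℝ] X →L[ℝ] ℝ)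
    (hpr : ∀ z : X, ∃ y : Y, ‖y‖ ≤ 1 ∧ pr y z = ‖z‖) (hle : ∀ y x, ‖pr y x‖ ≤ ‖y‖ * ‖x‖)
    {n : ℕ} {B : ℝ} (hB : ∀ (φ : Fin n → (Y →L[ℝ] ℝ)) (y : Fin n → Y), (∀ j, ‖φ j‖ ≤ 1) →
      (∀ i, ‖y i‖ ≤ 1) → |detForm φ y| ≤ B)
    (g : Fin n → (X →L[ℝ] ℝ)) (x : Fin n → X) (hg : ∀ j, ‖g j‖ ≤ 1) (hx : ∀ i, ‖x i‖ ≤ 1) :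
    |detForm g x| ≤ B := by
  have hclosed : IsClosed {A : Fin n → Fin n → ℝ | |(Matrix.of A).det| ≤ B} := by
    refine isClosed_le (Continuous.abs ?_) continuous_const
    exact Continuous.matrix_det (continuous_id (X := Fin n → Fin n → ℝ))
  have hsub : Set.pi Set.univ
      (fun _ : Fin n => (fun (y : Y) j => pr y (x j)) '' Metric.closedBall 0 1) ⊆
      {A : Fin n → Fin n → ℝ | |(Matrix.of A).det| ≤ B} := by
    intro A hA
    choose y hy1 hy2 using fun i => hA i (Set.mem_univ i)
    have h1 := hB (fun j => pr.flip (x j)) y (fun j => by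
      refine ContinuousLinearMap.opNorm_le_bound _ zero_le_one fun w => ?_
      refine (hle w (x j)).trans ?_
      rw [mul_comm]
      gcongr
      exact hx j) fun i => by simpa using hy1 i
    have h2 : A = fun i j => pr.flip (x j) (y i) := by
      ext i j
      rw [← hy2 i]
      rfl
    rw [Set.mem_ofPred_eq, h2]
    exact h1
  have hfin := closure_minimal hsub hclosed
  rw [closure_pi_set] at hfin
  have h1 := hfin (fun i _ => mem_closure_image_of_norming pr hpr x (g i) (hg i) :
    (fun i j => g i (x j)) ∈ _)
  rw [detForm_apply, ← Matrix.det_transpose]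
  exact h1

open MeasureTheory in
/-- The determinant bound in `L_p`, `2 ≤ p < ∞`. -/
theorem abs_detForm_le_of_two_le {Ω : Type*} [MeasurableSpace Ω] {ν : Measure Ω} {p : ℝ≥0∞}
    [hp : Fact (1 ≤ p)] (hp2 : 2 ≤ p) (hpt : p ≠ ∞) {n : ℕ} (g : Fin n → (Lp ℝ p ν →L[ℝ] ℝ))
    (x : Fin n → Lp ℝ p ν) (hg : ∀ j, ‖g j‖ ≤ 1) (hx : ∀ i, ‖x i‖ ≤ 1) :
    |detForm g x| ≤ ((n : ℝ) ^ (1 / 2 - p.toReal⁻¹)) ^ n := by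
  obtain ⟨q, hpq⟩ : ∃ q : ℝ≥0∞, ENNReal.HolderConjugate q p :=
    ⟨ENNReal.conjExponent p, (ENNReal.HolderConjugate.conjExponent hp.out).symm⟩
  have hq1 : Fact (1 ≤ q) := ⟨ENNReal.HolderConjugate.one_le q p⟩
  have hsum := hpq.inv_add_inv_eq_inv
  rw [inv_one] at hsum
  have hq2 : q ≤ 2 := by
    rw [← ENNReal.inv_le_inv]
    by_contra hcon
    push Not at hcon
    have h1 : q⁻¹ + p⁻¹ < 2⁻¹ + 2⁻¹ :=
      ENNReal.add_lt_add_of_lt_of_le (by simp; rintro rfl; simp at hp2) hcon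
        (ENNReal.inv_le_inv.mpr hp2)
    rw [hsum, ENNReal.inv_two_add_inv_two] at h1
    exact lt_irrefl _ h1
  have hexp : 1 / q.toReal - 1 / 2 = 1 / 2 - p.toReal⁻¹ := by
    have h1 := congrArg ENNReal.toReal hsum
    have hq0 : q ≠ 0 := (zero_lt_one.trans_le hq1.out).ne'
    have hp0 : p ≠ 0 := (zero_lt_one.trans_le hp.out).ne'
    rw [ENNReal.toReal_add (by simp [hq0]) (by simp [hp0]), ENNReal.toReal_inv,
      ENNReal.toReal_inv, ENNReal.toReal_one] at h1
    rw [one_div]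
    linarith
  rw [← hexp]
  exact abs_detForm_le_of_norming ((ContinuousLinearMap.mul ℝ ℝ).lpPairing ν q p)
    (exists_lpPairing_eq_norm hp2 hpt) norm_lpPairing_apply_le
    (abs_detForm_le_of_le_two hq2) g x hg hx

open MeasureTheory in
/-- The `n`-th Grothendieck number of `L_p` is at most `n ^ |1/2 - 1/p|`. -/
theorem abs_detForm_Lp_le {Ω : Type*} [MeasurableSpace Ω] {ν : Measure Ω} {p : ℝ≥0∞}
    [Fact (1 ≤ p)] {n : ℕ} (g : Fin n → (Lp ℝ p ν →L[ℝ] ℝ))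
    (x : Fin n → Lp ℝ p ν) (hg : ∀ j, ‖g j‖ ≤ 1) (hx : ∀ i, ‖x i‖ ≤ 1) :
    |detForm g x| ≤ ((n : ℝ) ^ |1 / 2 - p.toReal⁻¹|) ^ n := by
  rcases eq_or_ne p ∞ with rfl | hpt
  · simpa using abs_detForm_le_sqrt g x hg hx
  rcases le_total p 2 with hp2 | hp2
  · have h1 := abs_detForm_le_of_le_two hp2 g x hg hx
    have hP : p.toReal ≤ 2 := by simpa using ENNReal.toReal_mono (by simp) hp2
    have hP0 : 0 < p.toReal :=
      ENNReal.toReal_pos (zero_lt_one.trans_le (Fact.out : 1 ≤ p)).ne' hpt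
    have h2 := one_div_le_one_div_of_le hP0 hP
    rw [abs_of_nonpos (a := 1 / 2 - p.toReal⁻¹) (by rw [← one_div p.toReal]; linarith), neg_sub,
      ← one_div p.toReal]
    exact h1
  · have h1 := abs_detForm_le_of_two_le hp2 hpt g x hg hx
    have hP : 2 ≤ p.toReal := by simpa using ENNReal.toReal_mono hpt hp2
    have h2 := one_div_le_one_div_of_le two_pos hP
    rwa [abs_of_nonneg (a := 1 / 2 - p.toReal⁻¹) (by rw [← one_div p.toReal]; linarith)]

section MultiscaleExpansion

variable {X : Type*} [NormedAddCommGroup X] [NormedSpace ℝ X]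

/-- A multiscale bound for an alternating form: if the scales `k + 1, …, N` of every argument lie
in a subspace of dimension at most `D k`, then one may trade a weight `z k` per argument of scale
larger than `k` against a global factor `z k ^ D k`. -/
lemma abs_alternating_sum_le {n : ℕ} (ω : X [⋀^Fin n]→ₗ[ℝ] ℝ) {Γ : ℝ} (hΓ : 0 ≤ Γ)
    (hω : ∀ x, |ω x| ≤ Γ * ∏ i, ‖x i‖) (N : ℕ) (w : Fin n → ℕ → X) (a z D : ℕ → ℝ)
    (U : ℕ → Submodule ℝ X) (hfin : ∀ k, FiniteDimensional ℝ (U k))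
    (hU : ∀ k < N, (Module.finrank ℝ (U k) : ℝ) ≤ D k)
    (hw : ∀ j, ∀ k < N, ∀ i, k < i → i ≤ N → w j i ∈ U k)
    (ha : ∀ j, ∀ k ≤ N, ‖w j k‖ ≤ a k) (hz : ∀ k, 1 ≤ z k) :
    |ω fun j => ∑ k ∈ Finset.range (N + 1), w j k| ≤
      Γ * (∏ k ∈ Finset.range N, z k ^ D k) *
        (∑ k ∈ Finset.range (N + 1), a k / ∏ i ∈ Finset.range k, z i) ^ n := by
  classical
  have hz0 : ∀ k, 0 < z k := fun k => one_pos.trans_le (hz k)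
  have hZ : 0 ≤ ∏ k ∈ Finset.range N, z k ^ D k :=
    Finset.prod_nonneg fun k _ => Real.rpow_nonneg (hz0 k).le _
  have hexp := ω.toMultilinearMap.map_sum_finset (fun j k => w j k)
    (fun _ => Finset.range (N + 1))
  have hpow : (∑ k ∈ Finset.range (N + 1), a k / ∏ i ∈ Finset.range k, z i) ^ n =
      ∑ τ ∈ Fintype.piFinset fun _ : Fin n => Finset.range (N + 1),
        ∏ j, (a (τ j) / ∏ i ∈ Finset.range (τ j), z i) := by
    rw [← Finset.prod_univ_sum (fun _ : Fin n => Finset.range (N + 1))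
      (fun _ k => a k / ∏ i ∈ Finset.range k, z i)]
    simp
  change |ω.toMultilinearMap fun j => ∑ k ∈ Finset.range (N + 1), w j k| ≤ _
  rw [hexp, hpow, Finset.mul_sum]
  refine (Finset.abs_sum_le_sum_abs _ _).trans (Finset.sum_le_sum fun τ hτ => ?_)
  have hτN : ∀ j, τ j ≤ N := fun j =>
    Nat.lt_succ_iff.mp (Finset.mem_range.mp (Fintype.mem_piFinset.mp hτ j))
  have ha0 : ∀ j, 0 ≤ a (τ j) := fun j => (norm_nonneg _).trans (ha j _ (hτN j))
  have hrhs : 0 ≤ ∏ j, (a (τ j) / ∏ i ∈ Finset.range (τ j), z i) :=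
    Finset.prod_nonneg fun j _ =>
      div_nonneg (ha0 j) (Finset.prod_nonneg fun i _ => (hz0 i).le)
  change |ω fun j => w j (τ j)| ≤ _
  by_cases hli : LinearIndependent ℝ fun j => w j (τ j)
  · have hcard : ∀ k < N, ((Finset.univ.filter fun j => k < τ j).card : ℝ) ≤ D k := by
      intro k hk
      refine le_trans ?_ (hU k hk)
      have := hfin k
      let b : {j // k < τ j} → U k := fun j => ⟨w j.1 (τ j.1), hw _ _ hk _ j.2 (hτN _)⟩
      have hb : LinearIndependent ℝ b :=
        LinearIndependent.of_comp (U k).subtype (hli.comp _ Subtype.val_injective)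
      have := hb.fintype_card_le_finrank
      rw [Fintype.card_subtype] at this
      exact_mod_cast this
    have hprod : ∏ j, ∏ i ∈ Finset.range (τ j), z i ≤ ∏ k ∈ Finset.range N, z k ^ D k := by
      have h1 : ∀ j, ∏ i ∈ Finset.range (τ j), z i =
          ∏ i ∈ Finset.range N, if i < τ j then z i else 1 := by
        intro j
        rw [← Finset.prod_filter]
        refine Finset.prod_congr ?_ fun _ _ => rfl
        ext i
        simp only [Finset.mem_range, Finset.mem_filter]
        exact ⟨fun h => ⟨h.trans_le (hτN j), h⟩, fun h => h.2⟩
      simp_rw [h1]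
      rw [Finset.prod_comm]
      refine Finset.prod_le_prod (fun i _ => Finset.prod_nonneg fun j _ => ?_) fun i hi => ?_
      · split_ifs
        exacts [(hz0 i).le, zero_le_one]
      · rw [← Finset.prod_filter, Finset.prod_const, ← Real.rpow_natCast]
        exact Real.rpow_le_rpow_of_exponent_le (hz i) (hcard i (Finset.mem_range.mp hi))
    have hP : 0 < ∏ j, ∏ i ∈ Finset.range (τ j), z i :=
      Finset.prod_pos fun j _ => Finset.prod_pos fun i _ => hz0 i
    calc |ω fun j => w j (τ j)| ≤ Γ * ∏ j, ‖w j (τ j)‖ := hω _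
      _ ≤ Γ * ∏ j, a (τ j) := by
        gcongr with j
        exact ha j _ (hτN j)
      _ = Γ * (∏ j, ∏ i ∈ Finset.range (τ j), z i) *
          ∏ j, (a (τ j) / ∏ i ∈ Finset.range (τ j), z i) := by
        rw [Finset.prod_div_distrib]
        field_simp
      _ ≤ _ := by gcongr
  · rw [ω.map_linearDependent _ hli, abs_zero]
    positivity

end MultiscaleExpansion

section Widths

variable {X : Type*} [NormedAddCommGroup X] [NormedSpace ℝ X]

lemma infDist_submodule_le_norm (L : Submodule ℝ X) (x : X) :
    Metric.infDist x (L : Set X) ≤ ‖x‖ := by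
  simpa using Metric.infDist_le_dist_of_mem (x := x) (SetLike.mem_coe.mpr L.zero_mem)

/-- A strict bound on the Kolmogorov width of a compact set yields an approximating subspace. -/
lemma exists_submodule_of_kolWidth_lt {K : Set X} (hK : IsCompact K) (m : ℕ) {C : ℝ}
    (hC : 0 < C) (h : kolWidth K m < C) :
    ∃ L : Submodule ℝ X, FiniteDimensional ℝ L ∧ Module.finrank ℝ L ≤ m ∧
      ∀ g ∈ K, ∃ v ∈ L, ‖g - v‖ < C := by
  obtain ⟨R, hR⟩ := hK.isBounded.exists_norm_le
  have hbdd : ∀ φ : X → ℝ, (∀ g, 0 ≤ φ g ∧ φ g ≤ ‖g‖) → ∀ g ∈ K, φ g ≤ ⨆ g ∈ K, φ g := by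
    intro φ hφ g hg
    have hR' : ∀ g', ⨆ _ : g' ∈ K, φ g' ≤ max R 0 := fun g' =>
      Real.iSup_le (fun hg' => ((hφ g').2.trans (hR g' hg')).trans (le_max_left _ _))
        (le_max_right _ _)
    refine le_trans ?_ (le_ciSup (f := fun g' => ⨆ _ : g' ∈ K, φ g')
      ⟨max R 0, by rintro _ ⟨g', rfl⟩; exact hR' g'⟩ g)
    simp [hg]
  cases m with
  | zero =>
    refine ⟨⊥, inferInstance, by simp, fun g hg => ⟨0, by simp, ?_⟩⟩
    rw [sub_zero]
    exact (hbdd (fun g => ‖g‖) (fun g => ⟨norm_nonneg g, le_rfl⟩) g hg).trans_lt h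
  | succ m =>
    by_cases hne : Nonempty {L : Submodule ℝ X // Module.finrank ℝ L = m + 1}
    · obtain ⟨⟨L, hL⟩, hLC⟩ := exists_lt_of_ciInf_lt h
      refine ⟨L, Module.finite_of_finrank_eq_succ hL, hL.le, fun g hg => ?_⟩
      have h1 := (hbdd (fun g => Metric.infDist g (L : Set X)) (fun g =>
        ⟨Metric.infDist_nonneg, infDist_submodule_le_norm L g⟩) g hg).trans_lt hLC
      obtain ⟨v, hv, hgv⟩ := (Metric.infDist_lt_iff ⟨0, L.zero_mem⟩).mp h1
      exact ⟨v, hv, by rwa [← dist_eq_norm]⟩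
    · have hrank : Module.rank ℝ X < ((m + 1 : ℕ) : Cardinal) := by
        by_contra! hle
        obtain ⟨v, hv⟩ := Module.le_rank_iff.mp hle
        exact hne ⟨⟨Submodule.span ℝ (Set.range v), by
          simpa using finrank_span_eq_card hv⟩⟩
      have hfd : FiniteDimensional ℝ X :=
        Module.rank_lt_aleph0_iff.mp (hrank.trans (Cardinal.natCast_lt_aleph0))
      refine ⟨⊤, inferInstance, ?_, fun g _ => ⟨g, trivial, by simpa using hC⟩⟩
      rw [finrank_top]
      exact (Module.finrank_lt_of_rank_lt hrank).le

end Widths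

section Greedy

variable {X : Type*} [NormedAddCommGroup X] [NormedSpace ℝ X]

instance finiteDimensional_greedySpan (f : ℕ → X) (n : ℕ) :
    FiniteDimensional ℝ (greedySpan f n) :=
  FiniteDimensional.span_of_finite ℝ ((Set.finite_Iio n).image f)

/-- A norming functional for the distance from `f n` to `greedySpan f n`. -/
lemma exists_functional_greedyErr (f : ℕ → X) (n : ℕ) :
    ∃ g : X →L[ℝ] ℝ, ‖g‖ ≤ 1 ∧ (∀ i < n, g (f i) = 0) ∧ g (f n) = greedyErr f n := by
  have : IsClosed (greedySpan f n : Set X) := Submodule.closed_of_finiteDimensional _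
  have hnorm : ∀ x : X, ‖(greedySpan f n).mkQL x‖ = Metric.infDist x (greedySpan f n) :=
    fun x => QuotientAddGroup.norm_mk (S := (greedySpan f n).toAddSubgroup) x
  obtain ⟨g, hg, hgx⟩ := exists_dual_vector'' ℝ ((greedySpan f n).mkQL (f n))
  refine ⟨g.comp (greedySpan f n).mkQL, ?_, fun i hi => ?_, ?_⟩
  · refine ContinuousLinearMap.opNorm_le_bound _ zero_le_one fun x => ?_
    refine (g.le_of_opNorm_le hg _).trans ?_
    rw [one_mul, one_mul]
    exact (hnorm x).trans_le (infDist_submodule_le_norm _ x)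
  · have hmem : f i ∈ greedySpan f n := Submodule.subset_span ⟨i, hi, rfl⟩
    have h0 : (greedySpan f n).mkQL (f i) = 0 := by
      simpa using hmem
    rw [ContinuousLinearMap.comp_apply, h0, map_zero]
  · rw [ContinuousLinearMap.comp_apply, hgx]
    exact hnorm _

lemma IsGreedySeq.antitone_greedyErr {K : Set X} {f : ℕ → X} (hf : IsGreedySeq K f) :
    Antitone (greedyErr f) := by
  refine antitone_nat_of_succ_le fun n => ?_
  refine le_trans ?_ ((hf n).2 _ (hf (n + 1)).1)
  refine Metric.infDist_le_infDist_of_subset ?_ ⟨0, (greedySpan f n).zero_mem⟩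
  exact Submodule.span_mono (Set.image_mono (Set.Iio_subset_Iio n.le_succ))

/-- The `n`-th power of the greedy error is dominated by a triangular determinant. -/
lemma IsGreedySeq.exists_pow_greedyErr_le {K : Set X} {f : ℕ → X} (hf : IsGreedySeq K f)
    (n : ℕ) : ∃ g : Fin n → (X →L[ℝ] ℝ), (∀ j, ‖g j‖ ≤ 1) ∧
      greedyErr f n ^ n ≤ |detForm g fun i => f i| := by
  choose g hg hg0 hg1 using exists_functional_greedyErr f
  refine ⟨fun j => g j, fun j => hg j, ?_⟩
  have hdet : detForm (fun j : Fin n => g j) (fun i : Fin n => f i) =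
      ∏ i : Fin n, greedyErr f i := by
    rw [detForm_apply, Matrix.det_of_isLowerTriangular]
    · exact Finset.prod_congr rfl fun i _ => hg1 i
    · intro i j hij
      exact hg0 j i hij
  rw [hdet, Finset.abs_prod]
  calc greedyErr f n ^ n = ∏ _i : Fin n, greedyErr f n := by simp
    _ ≤ _ := Finset.prod_le_prod (fun _ _ => Metric.infDist_nonneg) fun i _ =>
      (hf.antitone_greedyErr i.2.le).trans (le_abs_self _)

end Greedy

section MultiscaleExpansion

variable {X : Type*} [NormedAddCommGroup X] [NormedSpace ℝ X]

lemma finrank_finset_sup_le {ι : Type*} (S : Finset ι) (L : ι → Submodule ℝ X)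
    (hL : ∀ i, FiniteDimensional ℝ (L i)) :
    Module.finrank ℝ (S.sup L : Submodule ℝ X) ≤ ∑ i ∈ S, Module.finrank ℝ (L i) := by
  classical
  induction S using Finset.induction_on with
  | empty => simp
  | insert i S hi ih =>
    rw [Finset.sup_insert, Finset.sum_insert hi]
    have := Submodule.finiteDimensional_finset_sup S L
    exact (Submodule.finrank_add_le_finrank_add_finrank _ _).trans (by gcongr)

lemma sum_Ico_quarter_pow_le (k m : ℕ) :
    ∑ i ∈ Finset.Ico k m, (1 / 4 : ℝ) ^ i ≤ 4 / 3 * (1 / 4) ^ k := by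
  refine (geom_sum_Ico_le_of_lt_one (by norm_num) (by norm_num)).trans_eq ?_
  ring

/-- The multiscale bound for arguments that are approximated at rate `A * 4 ^ (s * k)` by
subspaces of dimension `2 ^ e / 4 ^ k`. -/
lemma abs_alternating_le_of_approx {n : ℕ} (ω : X [⋀^Fin n]→ₗ[ℝ] ℝ) {Γ : ℝ} (hΓ : 0 ≤ Γ)
    (hω : ∀ x, |ω x| ≤ Γ * ∏ i, ‖x i‖) (e : ℕ) {A s : ℝ} (hA : 0 ≤ A) (hs : 0 ≤ s)
    (x : Fin n → X)
    (hL : ∀ k : ℕ, ∃ L : Submodule ℝ X, FiniteDimensional ℝ L ∧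
      Module.finrank ℝ L ≤ 2 ^ e / 4 ^ k ∧ ∀ j, ∃ v ∈ L, ‖x j - v‖ ≤ A * ((4 : ℝ) ^ s) ^ k) :
    |ω x| ≤ Γ * (2 : ℝ) ^ ((2 : ℝ) ^ e * (44 + 32 * s) / 9) * (4 / 3 * A) ^ n := by
  choose L hLfin hLrank v hvL hv using hL
  set q : ℝ := (4 : ℝ) ^ s with hq
  have hq1 : 1 ≤ q := Real.one_le_rpow (by norm_num) hs
  have hq0 : 0 < q := by positivity
  set M : ℝ := (2 : ℝ) ^ e with hM
  have hM0 : 0 < M := by positivity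
  have hrank : ∀ k, (Module.finrank ℝ (L k) : ℝ) ≤ M * (1 / 4) ^ k := by
    intro k
    have h1 : ((2 ^ e / 4 ^ k : ℕ) : ℝ) ≤ M / 4 ^ k := by
      simpa using Nat.cast_div_le (α := ℝ) (m := 2 ^ e) (n := 4 ^ k)
    calc (Module.finrank ℝ (L k) : ℝ) ≤ ((2 ^ e / 4 ^ k : ℕ) : ℝ) := by exact_mod_cast hLrank k
      _ ≤ M / 4 ^ k := h1
      _ = M * (1 / 4) ^ k := by rw [div_pow, one_pow, mul_one_div]
  set N := e + 1
  let y : Fin n → ℕ → X := fun j k => k.casesOn (x j) fun k => v k j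
  let w : Fin n → ℕ → X := fun j k => y j k - y j (k + 1)
  let a : ℕ → ℝ := fun k => if k = 0 then A else 2 * A * q ^ k
  let z : ℕ → ℝ := fun k => if k = 0 then 2 * (4 * q) else 4 * q
  let D : ℕ → ℝ := fun k => 4 / 3 * (M * (1 / 4) ^ k)
  have hlast : ∀ j, v N j = 0 := by
    intro j
    have hlt : 2 ^ e < 4 ^ N :=
      (Nat.pow_le_pow_left (by norm_num : 2 ≤ 4) e).trans_lt
        (Nat.pow_lt_pow_right (by norm_num) e.lt_succ_self)
    have h0 : Module.finrank ℝ (L N) = 0 := by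
      have := hLrank N
      rw [Nat.div_eq_of_lt hlt] at this
      omega
    have := hLfin N
    have hbot : L N = ⊥ := Submodule.finrank_eq_zero.mp h0
    simpa [hbot] using hvL N j
  have hsum : ∀ j, ∑ k ∈ Finset.range (N + 1), w j k = x j := by
    intro j
    rw [Finset.sum_range_sub' (y j) (N + 1)]
    change x j - v N j = x j
    rw [hlast, sub_zero]
  have hy : ∀ j k, y j (k + 1) ∈ L k := fun j k => hvL k j
  have key := abs_alternating_sum_le ω hΓ hω N w a z D
    (fun k => (Finset.Ico k (N + 1)).sup L)
    (fun k => Submodule.finiteDimensional_finset_sup _ _)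
    (by
      intro k _
      calc (Module.finrank ℝ ((Finset.Ico k (N + 1)).sup L : Submodule ℝ X) : ℝ)
          ≤ ∑ i ∈ Finset.Ico k (N + 1), (Module.finrank ℝ (L i) : ℝ) := by
            exact_mod_cast finrank_finset_sup_le _ L hLfin
        _ ≤ ∑ i ∈ Finset.Ico k (N + 1), M * (1 / 4) ^ i :=
            Finset.sum_le_sum fun i _ => hrank i
        _ ≤ M * (4 / 3 * (1 / 4) ^ k) := by
            rw [← Finset.mul_sum]
            gcongr
            exact sum_Ico_quarter_pow_le _ _
        _ = D k := by ring)
    (by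
      intro j k _ i hki hiN
      have hmem : ∀ l, k ≤ l → l ≤ N → y j (l + 1) ∈ (Finset.Ico k (N + 1)).sup L :=
        fun l hkl hlN => (Finset.le_sup (f := L)
          (Finset.mem_Ico.mpr ⟨hkl, Nat.lt_succ_of_le hlN⟩)) (hy j l)
      obtain ⟨l, rfl⟩ : ∃ l, i = l + 1 := ⟨i - 1, by omega⟩
      exact Submodule.sub_mem _ (hmem l (by omega) (by omega)) (hmem (l + 1) (by omega) hiN))
    (by
      intro j k _
      cases k with
      | zero => simpa [w, y, a] using hv 0 j
      | succ k =>
        have h1 := hv k j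
        have h2 := hv (k + 1) j
        have h3 : A * q ^ k ≤ A * q ^ (k + 1) := by
          gcongr
          omega
        have h4 : ‖v k j - v (k + 1) j‖ ≤ ‖x j - v k j‖ + ‖x j - v (k + 1) j‖ := by
          rw [norm_sub_rev (x j) (v k j)]
          exact norm_sub_le_norm_sub_add_norm_sub _ _ _
        change ‖v k j - v (k + 1) j‖ ≤ if k + 1 = 0 then A else 2 * A * q ^ (k + 1)
        rw [if_neg k.succ_ne_zero]
        linarith)
    (by
      intro k
      simp only [z]
      split_ifs <;> linarith)
  simp only [hsum] at key
  refine key.trans ?_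
  have hZ : ∀ k, ∏ i ∈ Finset.range k, z i = if k = 0 then 1 else 2 * (4 * q) ^ k := by
    intro k
    induction k with
    | zero => simp
    | succ k ih =>
      rw [Finset.prod_range_succ, ih]
      rcases k with _ | k
      · simp [z]
      · simp only [z, Nat.succ_ne_zero, if_false]
        ring
  have hSum : ∑ k ∈ Finset.range (N + 1), a k / ∏ i ∈ Finset.range k, z i ≤ 4 / 3 * A := by
    calc ∑ k ∈ Finset.range (N + 1), a k / ∏ i ∈ Finset.range k, z i
        = ∑ k ∈ Finset.Ico 0 (N + 1), A * (1 / 4) ^ k := by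
          rw [Finset.range_eq_Ico]
          refine Finset.sum_congr rfl fun k _ => ?_
          rw [hZ]
          rcases k with _ | k
          · simp [a]
          · simp only [a, Nat.succ_ne_zero, if_false]
            rw [mul_pow, div_pow, one_pow]
            field_simp
      _ ≤ A * (4 / 3 * (1 / 4) ^ 0) := by
          rw [← Finset.mul_sum]
          gcongr
          exact sum_Ico_quarter_pow_le _ _
      _ = 4 / 3 * A := by ring
  have hSum0 : 0 ≤ ∑ k ∈ Finset.range (N + 1), a k / ∏ i ∈ Finset.range k, z i := by
    refine Finset.sum_nonneg fun k _ => div_nonneg ?_ ?_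
    · simp only [a]
      split_ifs <;> positivity
    · rw [hZ]
      split_ifs <;> positivity
  have hProd : ∏ k ∈ Finset.range N, z k ^ D k ≤ (2 : ℝ) ^ (M * (44 + 32 * s) / 9) := by
    have hsplit : ∏ k ∈ Finset.range N, z k ^ D k =
        2 ^ D 0 * (4 * q) ^ ∑ k ∈ Finset.range N, D k := by
      rw [Real.rpow_sum_of_pos (by positivity), Finset.prod_range_succ', Finset.prod_range_succ']
      simp only [z, Nat.succ_ne_zero, if_false, if_true]
      rw [Real.mul_rpow (by norm_num) (by positivity)]
      ring
    have hDsum : ∑ k ∈ Finset.range N, D k ≤ 16 / 9 * M := by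
      calc ∑ k ∈ Finset.range N, D k = 4 / 3 * M * ∑ k ∈ Finset.Ico 0 N, (1 / 4 : ℝ) ^ k := by
            rw [Finset.range_eq_Ico, Finset.mul_sum]
            exact Finset.sum_congr rfl fun k _ => by simp only [D]; ring
        _ ≤ 4 / 3 * M * (4 / 3 * (1 / 4) ^ 0) := by
            gcongr
            exact sum_Ico_quarter_pow_le _ _
        _ = 16 / 9 * M := by ring
    have h4q : 4 * q = (2 : ℝ) ^ (2 * (1 + s)) := by
      rw [Real.rpow_mul (by norm_num), Real.rpow_add (by norm_num), hq]
      norm_num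
    calc ∏ k ∈ Finset.range N, z k ^ D k
        ≤ 2 ^ D 0 * (4 * q) ^ (16 / 9 * M) := by
          rw [hsplit]
          gcongr
          linarith
      _ = (2 : ℝ) ^ (M * (44 + 32 * s) / 9) := by
          rw [h4q, ← Real.rpow_mul (by norm_num), ← Real.rpow_add (by norm_num)]
          congr 1
          simp only [D]
          ring
  gcongr

end MultiscaleExpansion

lemma two_rpow_le {a : ℝ} {x : ℝ} (k m : ℕ) (hk : k ≠ 0) (hx : 0 ≤ x) (h : a = m / k)
    (hp : (2 : ℝ) ^ m ≤ x ^ k) : (2 : ℝ) ^ a ≤ x := by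
  rw [← pow_le_pow_iff_left₀ (by positivity) hx hk, ← Real.rpow_natCast,
    ← Real.rpow_mul (by norm_num), h, div_mul_cancel₀ _ (by exact_mod_cast hk), Real.rpow_natCast]
  exact hp

lemma four_thirds_two_rpow_le_sqrt_logb {n M : ℝ} (hn : 17 ≤ n) (hM : 6.2 * M ≤ n)
    (hM2 : n ≤ 24 → M ≤ 2) (hn25 : 24 < n → 25 ≤ n) :
    4 / 3 * (2 : ℝ) ^ (44 / 9 * (M / n)) ≤ √(Real.logb 2 (2 * n)) := by
  have hn0 : 0 < n := by linarith
  have hsq : (4 / 3 * (2 : ℝ) ^ (44 / 9 * (M / n))) ^ 2 =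
      16 / 9 * (2 : ℝ) ^ (88 / 9 * (M / n)) := by
    rw [mul_pow, ← Real.rpow_natCast (2 ^ _), ← Real.rpow_mul (by norm_num)]
    norm_num
    ring_nf
  refine Real.le_sqrt_of_sq_le ?_
  rw [hsq]
  rcases le_or_gt n 24 with h | h
  · have hr : 88 / 9 * (M / n) ≤ 6 / 5 := by
      rw [← mul_div_assoc, div_le_iff₀ hn0]
      linarith [hM2 h]
    have h2 : (2 : ℝ) ^ (6 / 5 : ℝ) ≤ 2.3 :=
      two_rpow_le 5 6 (by norm_num) (by norm_num) (by norm_num) (by norm_num)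
    have hlog : 5 ≤ Real.logb 2 (2 * n) := by
      rw [Real.le_logb_iff_rpow_le (by norm_num) (by positivity)]
      norm_num
      linarith
    have := Real.rpow_le_rpow_of_exponent_le (x := 2) (by norm_num) hr
    linarith
  · have hr : 88 / 9 * (M / n) ≤ 8 / 5 := by
      rw [← mul_div_assoc, div_le_iff₀ hn0]
      linarith
    have h2 : (2 : ℝ) ^ (8 / 5 : ℝ) ≤ 3.04 :=
      two_rpow_le 5 8 (by norm_num) (by norm_num) (by norm_num) (by norm_num)
    have hlog : 11 / 2 ≤ Real.logb 2 (2 * n) := by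
      rw [Real.le_logb_iff_rpow_le (by norm_num) (by positivity)]
      refine (two_rpow_le (x := 50) 2 11 ?_ ?_ ?_ ?_).trans ?_ <;> norm_num
      linarith [hn25 h]
    have := Real.rpow_le_rpow_of_exponent_le (x := 2) (by norm_num) hr
    linarith

/-- The numerical choice of the finest scale. -/
lemma exists_scale_bound {n : ℕ} (hn : 17 ≤ n) {s : ℝ} (hs : 0 ≤ s) :
    ∃ e : ℕ, (2 : ℝ) ^ ((2 : ℝ) ^ e * (44 + 32 * s) / 9 / n) * (4 / 3 * ((2 : ℝ) ^ e) ^ (-s)) ≤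
      16 ^ s * √(Real.logb 2 (2 * n)) * (n : ℝ) ^ (-s) := by
  have hnR : (17 : ℝ) ≤ n := by exact_mod_cast hn
  have hn0 : (0 : ℝ) < n := by linarith
  obtain ⟨e, he1, he2⟩ := exists_nat_pow_near (x := (n : ℝ) / 6.2) (y := 2)
    (by rw [le_div_iff₀ (by norm_num)]; linarith) (by norm_num)
  refine ⟨e, ?_⟩
  rw [le_div_iff₀ (by norm_num)] at he1
  rw [div_lt_iff₀ (by norm_num), pow_succ] at he2
  have hM2 : (n : ℝ) ≤ 24 → (2 : ℝ) ^ e ≤ 2 := by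
    intro h24
    have h4 : (2 : ℝ) ^ e < 2 ^ 2 := by linarith
    have : e < 2 := (pow_lt_pow_iff_right₀ (by norm_num)).mp h4
    simpa using pow_le_pow_right₀ (by norm_num : (1 : ℝ) ≤ 2) (Nat.lt_succ_iff.mp this)
  set M : ℝ := (2 : ℝ) ^ e
  have hM0 : 0 < M := by positivity
  have hsqrt := four_thirds_two_rpow_le_sqrt_logb hnR (by linarith) hM2
    (fun h => by
      have : 24 < n := by exact_mod_cast h
      exact_mod_cast this)
  have hr0 : 0 ≤ 32 / 9 * (M / n) := by positivity
  have hr1 : 32 / 9 * (M / n) ≤ 1 := by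
    rw [← mul_div_assoc, div_le_one hn0]
    linarith
  have hbern : (2 : ℝ) ^ (32 / 9 * (M / n)) ≤ 1 + 32 / 9 * (M / n) := by
    have := rpow_one_add_le_one_add_mul_self (s := 1) (by norm_num) hr0 hr1
    norm_num at this ⊢
    exact this
  have hbase : (2 : ℝ) ^ (32 / 9 * (M / n)) / M ≤ 16 / n := by
    rw [div_le_div_iff₀ hM0 hn0]
    calc (2 : ℝ) ^ (32 / 9 * (M / n)) * n ≤ (1 + 32 / 9 * (M / n)) * n := by gcongr
      _ = n + 32 / 9 * M := by field_simp
      _ ≤ 16 * M := by linarith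
  have hsplit : (2 : ℝ) ^ (M * (44 + 32 * s) / 9 / n) * (4 / 3 * M ^ (-s)) =
      (4 / 3 * (2 : ℝ) ^ (44 / 9 * (M / n))) * ((2 : ℝ) ^ (32 / 9 * (M / n)) / M) ^ s := by
    rw [Real.div_rpow (by positivity) hM0.le, ← Real.rpow_mul (by norm_num),
      Real.rpow_neg hM0.le, show M * (44 + 32 * s) / 9 / n =
        44 / 9 * (M / n) + 32 / 9 * (M / n) * s by ring, Real.rpow_add (by norm_num)]
    ring
  calc (2 : ℝ) ^ (M * (44 + 32 * s) / 9 / n) * (4 / 3 * M ^ (-s))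
      ≤ √(Real.logb 2 (2 * n)) * (16 / n) ^ s := by
        rw [hsplit]
        gcongr
    _ = 16 ^ s * √(Real.logb 2 (2 * n)) * (n : ℝ) ^ (-s) := by
        rw [Real.div_rpow (by norm_num) hn0.le, Real.rpow_neg hn0.le]
        ring


section Rates

variable {X : Type*} [NormedAddCommGroup X] [NormedSpace ℝ X]

lemma IsGreedySeq.greedyErr_le_of_kolWidth_zero_lt {K : Set X} (hK : IsCompact K) {C : ℝ}
    (hC : 0 < C) (h : kolWidth K 0 < C) {f : ℕ → X} (hf : IsGreedySeq K f) (n : ℕ) :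
    greedyErr f n ≤ C := by
  obtain ⟨L, hfin, hrank, hL⟩ := exists_submodule_of_kolWidth_lt hK 0 hC h
  have hbot : L = ⊥ := Submodule.finrank_eq_zero.mp (Nat.le_zero.mp hrank)
  obtain ⟨v, hv, hfv⟩ := hL _ (hf n).1
  rw [hbot, Submodule.mem_bot] at hv
  rw [hv, sub_zero] at hfv
  exact (infDist_submodule_le_norm _ _).trans hfv.le

lemma two_pow_div_four_pow_le_max (e k : ℕ) :
    (2 : ℝ) ^ e / 4 ^ k ≤ max 1 ((2 ^ e / 4 ^ k : ℕ) : ℝ) := by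
  have h4 : (4 : ℕ) ^ k = 2 ^ (2 * k) := by rw [pow_mul]; norm_num
  rcases le_total (2 * k) e with h | h
  · refine le_max_of_le_right (le_of_eq ?_)
    rw [Nat.cast_div (h4 ▸ pow_dvd_pow 2 h) (by positivity)]
    norm_num
  · refine le_max_of_le_left ?_
    rw [div_le_one (by positivity)]
    have := Nat.pow_le_pow_right (n := 2) (by norm_num) h
    rw [← h4] at this
    exact_mod_cast this

/-- The determinant method: a bound on the determinants of unit vectors and unit functionals and
polynomial decay of the widths give polynomial decay of the greedy errors. -/
lemma IsGreedySeq.greedyErr_le_of_abs_detForm_le {K : Set X} (hK : IsCompact K) {C s α : ℝ}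
    (hC : 0 < C) (hs : 0 ≤ s) (hα : 0 ≤ α) {n : ℕ} (hn : 2 ≤ n)
    (hd : ∀ m : ℕ, kolWidth K m < C * (max 1 (m : ℝ)) ^ (-s))
    (hdet : ∀ (g : Fin n → (X →L[ℝ] ℝ)) (x : Fin n → X), (∀ j, ‖g j‖ ≤ 1) → (∀ i, ‖x i‖ ≤ 1) →
      |detForm g x| ≤ ((n : ℝ) ^ α) ^ n)
    {f : ℕ → X} (hf : IsGreedySeq K f) :
    greedyErr f n ≤
      C * ((16 : ℝ) ^ s * √(Real.logb 2 (2 * n)) * (n : ℝ) ^ (-s) * (n : ℝ) ^ α) := by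
  have hnR : (2 : ℝ) ≤ n := by exact_mod_cast hn
  have hn0 : (0 : ℝ) < n := by linarith
  rcases le_or_gt n 16 with h16 | h16
  · have h1 : 1 ≤ (16 : ℝ) ^ s * (n : ℝ) ^ (-s) := by
      rw [Real.rpow_neg hn0.le, ← div_eq_mul_inv, ← Real.div_rpow (by norm_num) hn0.le]
      refine Real.one_le_rpow ?_ hs
      rw [one_le_div hn0]
      exact_mod_cast h16
    have h2 : 1 ≤ √(Real.logb 2 (2 * n)) := by
      rw [Real.one_le_sqrt, Real.le_logb_iff_rpow_le (by norm_num) (by positivity)]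
      norm_num
      linarith
    have h3 : 1 ≤ (n : ℝ) ^ α := Real.one_le_rpow (by linarith) hα
    have h0 : kolWidth K 0 < C := by simpa using hd 0
    refine (hf.greedyErr_le_of_kolWidth_zero_lt hK hC h0 n).trans ?_
    rw [mul_right_comm ((16 : ℝ) ^ s)]
    exact le_mul_of_one_le_right hC.le
      (one_le_mul_of_one_le_of_one_le (one_le_mul_of_one_le_of_one_le h1 h2) h3)
  · obtain ⟨e, he⟩ := exists_scale_bound h16 hs
    obtain ⟨g, hg, hgf⟩ := hf.exists_pow_greedyErr_le n
    have hΓ : 0 ≤ ((n : ℝ) ^ α) ^ n := by positivity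
    have happrox : ∀ k : ℕ, ∃ L : Submodule ℝ X, FiniteDimensional ℝ L ∧
        Module.finrank ℝ L ≤ 2 ^ e / 4 ^ k ∧
        ∀ j : Fin n, ∃ v ∈ L, ‖f j - v‖ ≤ C * ((2 : ℝ) ^ e) ^ (-s) * ((4 : ℝ) ^ s) ^ k := by
      intro k
      obtain ⟨L, hfin, hrank, hL⟩ := exists_submodule_of_kolWidth_lt hK (2 ^ e / 4 ^ k)
        (by positivity) (hd (2 ^ e / 4 ^ k))
      refine ⟨L, hfin, hrank, fun j => ?_⟩
      obtain ⟨v, hv, hfv⟩ := hL _ (hf j).1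
      refine ⟨v, hv, hfv.le.trans ?_⟩
      rw [mul_assoc]
      gcongr
      refine (Real.rpow_le_rpow_of_nonpos (by positivity) (two_pow_div_four_pow_le_max e k)
        (neg_nonpos.mpr hs)).trans_eq ?_
      rw [Real.div_rpow (by positivity) (by positivity), Real.rpow_neg (x := 4 ^ k) (by positivity),
        div_inv_eq_mul, ← Real.rpow_natCast, ← Real.rpow_natCast, ← Real.rpow_natCast,
        ← Real.rpow_mul (x := 4) (by norm_num), ← Real.rpow_mul (x := 4) (by norm_num),
        mul_comm s]
    have key := abs_alternating_le_of_approx (detForm g) hΓ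
      (fun x => abs_detForm_le_of_unit hdet g hg x) e (by positivity) hs (fun i => f i) happrox
    have hpow : greedyErr f n ^ n ≤ ((n : ℝ) ^ α *
        (2 : ℝ) ^ ((2 : ℝ) ^ e * (44 + 32 * s) / 9 / n) *
          (4 / 3 * (C * ((2 : ℝ) ^ e) ^ (-s)))) ^ n := by
      refine (hgf.trans key).trans_eq ?_
      have h2 : (2 : ℝ) ^ ((2 : ℝ) ^ e * (44 + 32 * s) / 9) =
          ((2 : ℝ) ^ ((2 : ℝ) ^ e * (44 + 32 * s) / 9 / n)) ^ n := by
        rw [← Real.rpow_mul_natCast (by norm_num), div_mul_cancel₀ _ hn0.ne']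
      rw [h2]
      ring
    calc greedyErr f n ≤ _ :=
          le_of_pow_le_pow_left₀ (by omega) (by positivity) hpow
      _ = C * (((2 : ℝ) ^ ((2 : ℝ) ^ e * (44 + 32 * s) / 9 / n) *
            (4 / 3 * ((2 : ℝ) ^ e) ^ (-s))) * (n : ℝ) ^ α) := by ring
      _ ≤ _ := by gcongr

end Rates

theorem greedy_rate_in_Lp
    {Ω : Type*} [MeasurableSpace Ω] (ν : MeasureTheory.Measure Ω)
    (p : ℝ≥0∞) [Fact (1 ≤ p)]
    (K : Set (MeasureTheory.Lp ℝ p ν)) (hKc : IsCompact K) (hKne : K.Nonempty)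
    (C0 s : ℝ) (hC0 : 0 < C0) (hs : |1 / 2 - p.toReal⁻¹| < s)
    (hd : ∀ n : ℕ, kolWidth K n ≤ C0 * (max 1 (n : ℝ)) ^ (-s)) :
    ∀ f : ℕ → MeasureTheory.Lp ℝ p ν, IsGreedySeq K f → ∀ n : ℕ, 2 ≤ n →
      greedyErr f n ≤ C0 * (16 : ℝ) ^ s * (2 : ℝ) ^ |1 / 2 - p.toReal⁻¹| *
        Real.sqrt (Real.logb 2 (2 * n)) * (n : ℝ) ^ (-s + |1 / 2 - p.toReal⁻¹|) := by
  intro f hf n hn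
  have hn0 : (0 : ℝ) < n := by exact_mod_cast (by omega : 0 < n)
  set α := |1 / 2 - p.toReal⁻¹|
  have hα : 0 ≤ α := abs_nonneg _
  set Q := (16 : ℝ) ^ s * √(Real.logb 2 (2 * n)) * (n : ℝ) ^ (-s) * (n : ℝ) ^ α with hQ
  have hlog : 0 ≤ Real.logb 2 (2 * n) := by
    refine Real.logb_nonneg (by norm_num) ?_
    have : (2 : ℝ) ≤ n := by exact_mod_cast hn
    linarith
  have hbound : ∀ C, C0 < C → greedyErr f n ≤ C * Q := fun C hC =>
    hf.greedyErr_le_of_abs_detForm_le hKc (hC0.trans hC) (hα.trans hs.le) hα hn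
      (fun m => (hd m).trans_lt (by gcongr)) (fun g x hg hx => abs_detForm_Lp_le g x hg hx)
  have hlim : greedyErr f n ≤ C0 * Q := by
    have hcont : Filter.Tendsto (fun C => C * Q) (nhdsWithin C0 (Set.Ioi C0)) (nhds (C0 * Q)) :=
      ((continuous_mul_const Q).tendsto C0).mono_left nhdsWithin_le_nhds
    exact ge_of_tendsto hcont (eventually_nhdsWithin_of_forall fun C hC => hbound C hC)
  calc greedyErr f n ≤ C0 * Q := hlim
    _ ≤ (2 : ℝ) ^ α * (C0 * Q) :=
      le_mul_of_one_le_left (by positivity) (Real.one_le_rpow (by norm_num) hα)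
    _ = _ := by
      rw [Real.rpow_add hn0, hQ]
      ring
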